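/- Let n be an even positive integer divisible by 4 and let G = Cay(Z_n, S) be a circulant graph whose symmetric connection set S ⊆ Z_n \ {0} satisfies: (i) n/2 ∉ S; (ii) S contains the subset S_1 = {1, 2, …, n/4} ∪ {n − n/4, …, n − 2, n − 1}; (iii) the set S \ S_1 generates the group Z_n; and |S| = Δ(G) ≥ n/2. Then G satisfies the Total Coloring Conjecture: χ''(G) ≤ Δ(G) + 2. -/

import Mathlib

open SimpleGraph

/-- A total coloring of `G` with `t` colors: a vertex coloring `cv` and an edge coloring `ce`
such that adjacent vertices get distinct colors, distinct edges sharing an endpoint get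
distinct colors, and every edge gets a color distinct from those of its endpoints. -/
def IsTotalColoring {V : Type*} (G : SimpleGraph V) {t : ℕ}
    (cv : V → Fin t) (ce : Sym2 V → Fin t) : Prop :=
  (∀ u v : V, G.Adj u v → cv u ≠ cv v) ∧
  (∀ e₁ ∈ G.edgeSet, ∀ e₂ ∈ G.edgeSet, e₁ ≠ e₂ → (∃ u : V, u ∈ e₁ ∧ u ∈ e₂) →
    ce e₁ ≠ ce e₂) ∧
  (∀ e ∈ G.edgeSet, ∀ u : V, u ∈ e → ce e ≠ cv u)

/-- The total chromatic number of `G`. -/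
noncomputable def totalChromaticNumber {V : Type*} (G : SimpleGraph V) : ℕ :=
  sInf {t : ℕ | ∃ cv : V → Fin t, ∃ ce : Sym2 V → Fin t, IsTotalColoring G cv ce}

/-- The size of the color class of color `c`: vertices plus edges colored `c`. -/
noncomputable def totalClassSize {V : Type*} (G : SimpleGraph V) {t : ℕ}
    (cv : V → Fin t) (ce : Sym2 V → Fin t) (c : Fin t) : ℕ :=
  {v : V | cv v = c}.ncard + {e : Sym2 V | e ∈ G.edgeSet ∧ ce e = c}.ncard

/-- An equitable total coloring: a total coloring whose color class sizes pairwise differ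
by at most one. -/
def IsEquitableTotalColoring {V : Type*} (G : SimpleGraph V) {t : ℕ}
    (cv : V → Fin t) (ce : Sym2 V → Fin t) : Prop :=
  IsTotalColoring G cv ce ∧
  ∀ c c' : Fin t, totalClassSize G cv ce c ≤ totalClassSize G cv ce c' + 1

/-- The equitable total chromatic number of `G`. -/
noncomputable def equitableTotalChromaticNumber {V : Type*} (G : SimpleGraph V) : ℕ :=
  sInf {t : ℕ | ∃ cv : V → Fin t, ∃ ce : Sym2 V → Fin t, IsEquitableTotalColoring G cv ce}

/-- The color sum at a vertex `u`: the color of `u` plus the colors of all edges incident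
with `u`, where color `c : Fin t` represents the integer color `c + 1 ∈ {1, …, t}`. -/
noncomputable def nsdSum {V : Type*} (G : SimpleGraph V) {t : ℕ}
    (cv : V → Fin t) (ce : Sym2 V → Fin t) (u : V) : ℕ :=
  ((cv u : ℕ) + 1) + ∑ᶠ e ∈ G.incidenceSet u, ((ce e : ℕ) + 1)

/-- A neighborhood sum distinguishing total coloring: a total coloring such that adjacent
vertices have distinct color sums. -/
def IsNSDTotalColoring {V : Type*} (G : SimpleGraph V) {t : ℕ}
    (cv : V → Fin t) (ce : Sym2 V → Fin t) : Prop :=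
  IsTotalColoring G cv ce ∧
  ∀ u v : V, G.Adj u v → nsdSum G cv ce u ≠ nsdSum G cv ce v

/-- The neighborhood sum distinguishing total chromatic number of `G`. -/
noncomputable def nsdTotalChromaticNumber {V : Type*} (G : SimpleGraph V) : ℕ :=
  sInf {t : ℕ | ∃ cv : V → Fin t, ∃ ce : Sym2 V → Fin t, IsNSDTotalColoring G cv ce}

/-- The power of cycle `C_n^k`: vertices `ZMod n`, with `x ~ y` iff `x - y ≡ ±j (mod n)`
for some `1 ≤ j ≤ k`. -/
def powerOfCycle (n k : ℕ) : SimpleGraph (ZMod n) :=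
  SimpleGraph.fromRel (fun x y => ∃ j : ℕ, 1 ≤ j ∧ j ≤ k ∧ x - y = (j : ZMod n))

/-- The circulant graph `Cay(ZMod n, S)`: `x ~ y` iff `x - y ∈ S` (symmetrized). -/
def cayley (n : ℕ) (S : Finset (ZMod n)) : SimpleGraph (ZMod n) :=
  SimpleGraph.fromRel (fun x y => x - y ∈ S)

instance cayley.instDecidableRelAdj (n : ℕ) (S : Finset (ZMod n)) :
    DecidableRel (cayley n S).Adj :=
  fun x y => inferInstanceAs (Decidable (x ≠ y ∧ (x - y ∈ S ∨ y - x ∈ S)))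

/-- A proper edge coloring of `H` by the colors in `K`, given as a symmetric function of the two
endpoints of an edge. -/
structure IsProperEdgeColoring {V κ : Type*} (H : SimpleGraph V) (c : V → V → κ)
    (K : Finset κ) : Prop where
  symm : ∀ x y, c x y = c y x
  mem : ∀ x y, H.Adj x y → c x y ∈ K
  inj : ∀ x y z, H.Adj x y → H.Adj x z → c x y = c x z → y = z

/-- `A u` is a set of colors of `K` that do not occur at `u`, for every `u ∈ N`. -/
def IsMissing {V κ : Type*} (H : SimpleGraph V) (c : V → V → κ) (K : Finset κ)
    (N : Finset V) (A : V → Finset κ) : Prop :=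
  ∀ u ∈ N, ∀ i ∈ A u, i ∈ K ∧ ∀ y, H.Adj u y → c u y ≠ i

/-- The subgraph formed by the edges colored `i` or `j`. -/
def kempeGraph {V κ : Type*} (H : SimpleGraph V) (c : V → V → κ) (hc : ∀ x y, c x y = c y x)
    (i j : κ) : SimpleGraph V where
  Adj x y := H.Adj x y ∧ (c x y = i ∨ c x y = j)
  symm := ⟨fun x y h => ⟨h.1.symm, by rw [hc y x]; exact h.2⟩⟩
  loopless := ⟨fun x h => H.loopless.irrefl x h.1⟩

section Vizing

open Finset
open scoped Classical

variable {V κ : Type*} {H : SimpleGraph V} {c : V → V → κ} {K : Finset κ}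

/-- Swapping `i` and `j` on a union of components of the Kempe graph. -/
lemma exists_kempe_swap (hc : IsProperEdgeColoring H c K) {i j : κ} (hi : i ∈ K) (hj : j ∈ K)
    (P : Set V) (hP : ∀ x y, (kempeGraph H c hc.symm i j).Adj x y → x ∈ P → y ∈ P) :
    ∃ c' : V → V → κ, IsProperEdgeColoring H c' K ∧
      ∀ x y, H.Adj x y → c' x y = if x ∈ P then Equiv.swap i j (c x y) else c x y := by
  have key : ∀ x y, H.Adj x y →
      (if x ∈ P ∧ y ∈ P then Equiv.swap i j (c x y) else c x y) =
        if x ∈ P then Equiv.swap i j (c x y) else c x y := by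
    intro x y h
    by_cases hx : x ∈ P
    · by_cases hy : y ∈ P
      · simp [hx, hy]
      · have h1 : ¬ (c x y = i ∨ c x y = j) := fun hh => hy (hP x y ⟨h, hh⟩ hx)
        push Not at h1
        simp [hx, hy, Equiv.swap_apply_of_ne_of_ne h1.1 h1.2]
    · simp [hx]
  refine ⟨fun x y => if x ∈ P ∧ y ∈ P then Equiv.swap i j (c x y) else c x y, ⟨?_, ?_, ?_⟩, key⟩
  · intro x y
    simp only [hc.symm x y, and_comm]
  · intro x y h
    have := hc.mem x y h
    split_ifs
    · rw [Equiv.swap_apply_def]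
      split_ifs <;> assumption
    · exact this
  · intro x y z hy hz h
    rw [key x y hy, key x z hz] at h
    refine hc.inj x y z hy hz ?_
    split_ifs at h
    · exact (Equiv.swap i j).injective h
    · exact h

lemma sum_sq_lt_of_transfer {ι : Type*} (K : Finset ι) {i j : ι} (hi : i ∈ K) (hj : j ∈ K)
    (hij : i ≠ j) (f g : ι → ℕ) (hfg : ∀ l ∈ K, l ≠ i → l ≠ j → g l = f l) (a b : ℕ)
    (hab : b < a) (hle : a ≤ b + 2) (hgi : g i + a = f i + b) (hgj : g j + b = f j + a)
    (hf : f j + 3 ≤ f i) : ∑ l ∈ K, g l ^ 2 < ∑ l ∈ K, f l ^ 2 := by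
  have hj' : j ∈ K.erase i := mem_erase.2 ⟨hij.symm, hj⟩
  rw [← add_sum_erase K _ hi, ← add_sum_erase K (fun l => f l ^ 2) hi,
    ← add_sum_erase _ _ hj', ← add_sum_erase _ (fun l => f l ^ 2) hj']
  have : ∑ l ∈ (K.erase i).erase j, g l ^ 2 = ∑ l ∈ (K.erase i).erase j, f l ^ 2 := by
    refine sum_congr rfl fun l hl => ?_
    simp only [mem_erase] at hl
    rw [hfg l hl.2.2 hl.2.1 hl.1]
  rw [this]
  obtain ⟨d, rfl⟩ := Nat.exists_eq_add_of_lt hab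
  have h1 : f i = g i + (d + 1) := by omega
  have h2 : g j = f j + (d + 1) := by omega
  rw [h1, h2]
  nlinarith

variable [Fintype V]

/-- A component of a Kempe graph misses `i` or `j` at most twice. -/
lemma card_missing_component_le (hc : IsProperEdgeColoring H c K) {i j : κ}
    {N : Finset V} {A : V → Finset κ} (hA : IsMissing H c K N A)
    (hij : i ≠ j) (C : (kempeGraph H c hc.symm i j).ConnectedComponent) :
    #{u ∈ N | i ∈ A u ∧ u ∈ C.supp} + #{u ∈ N | j ∈ A u ∧ u ∈ C.supp} ≤ 2 := by
  have hconn := C.connected_toSimpleGraph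
  have hcard := hconn.card_vert_le_card_edgeSet_add_one
  rw [Nat.card_eq_fintype_card, Nat.card_eq_fintype_card, ← edgeFinset_card] at hcard
  have hsum := C.toSimpleGraph.sum_degrees_eq_twice_card_edges
  have hdeg : ∀ x : C, C.toSimpleGraph.degree x +
      ((if (x : V) ∈ N ∧ i ∈ A x then 1 else 0) + (if (x : V) ∈ N ∧ j ∈ A x then 1 else 0)) ≤ 2 := by
    intro x
    have h1 : C.toSimpleGraph.degree x ≤
        #(({i, j} : Finset κ).filter fun l => ¬ ((x : V) ∈ N ∧ l ∈ A x)) := by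
      rw [← card_neighborFinset_eq_degree]
      refine card_le_card_of_injOn (fun y => c x y) ?_ ?_
      · intro y hy
        have hy' : (kempeGraph H c hc.symm i j).Adj x y := by
          have h : C.toSimpleGraph.Adj x y := by simpa using hy
          exact h
        simp only [coe_filter, Set.mem_ofPred_eq, mem_insert, mem_singleton]
        exact ⟨hy'.2, fun h => (hA x h.1 _ h.2).2 y hy'.1 rfl⟩
      · intro y hy z hz h
        have hy' : (kempeGraph H c hc.symm i j).Adj x y := by
          have h : C.toSimpleGraph.Adj x y := by simpa using hy
          exact h
        have hz' : (kempeGraph H c hc.symm i j).Adj x z := by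
          have h : C.toSimpleGraph.Adj x z := by simpa using hz
          exact h
        exact Subtype.ext (hc.inj x y z hy'.1 hz'.1 h)
    have h2 : #(({i, j} : Finset κ).filter fun l => ¬ ((x : V) ∈ N ∧ l ∈ A x)) =
        (if (x : V) ∈ N ∧ i ∈ A x then 0 else 1) + (if (x : V) ∈ N ∧ j ∈ A x then 0 else 1) := by
      rw [card_filter, sum_pair hij]
      simp only [ite_not]
    rw [h2] at h1
    split_ifs at h1 ⊢ <;> omega
  have htot := sum_le_sum fun x (_ : x ∈ (univ : Finset C)) => hdeg x
  rw [sum_add_distrib, sum_add_distrib, hsum] at htot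
  have hcount : ∀ l : κ, #{u ∈ N | l ∈ A u ∧ u ∈ C.supp} =
      ∑ x : C, if (x : V) ∈ N ∧ l ∈ A x then 1 else 0 := by
    intro l
    rw [← card_filter]
    refine (card_bij (fun (x : C) _ => (x : V)) ?_ ?_ ?_).symm
    · rintro ⟨x, hx⟩ h
      simp only [mem_filter, mem_univ, true_and] at h ⊢
      exact ⟨h.1, h.2, hx⟩
    · intro x _ y _ h
      exact Subtype.ext h
    · intro x hx
      simp only [mem_filter] at hx
      exact ⟨⟨x, hx.2.2⟩, by simp [hx.1, hx.2.1], rfl⟩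
  rw [hcount, hcount]
  simp only [sum_const, card_univ, smul_eq_mul] at htot
  omega

/-- If the color `i` is available much more often than `j`, a Kempe change makes the
distribution of available colors more even. -/
lemma exists_more_balanced (hc : IsProperEdgeColoring H c K) {i j : κ} (hi : i ∈ K) (hj : j ∈ K)
    {N : Finset V} {A : V → Finset κ} (hA : IsMissing H c K N A)
    (hlt : #{u ∈ N | j ∈ A u} + 3 ≤ #{u ∈ N | i ∈ A u}) :
    ∃ c' A', IsProperEdgeColoring H c' K ∧ IsMissing H c' K N A' ∧
      (∀ u, #(A' u) = #(A u)) ∧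
      ∑ l ∈ K, #{u ∈ N | l ∈ A' u} ^ 2 < ∑ l ∈ K, #{u ∈ N | l ∈ A u} ^ 2 := by
  have hij : i ≠ j := by rintro rfl; omega
  set Q := kempeGraph H c hc.symm i j with hQ
  have hfib : ∀ l, #{u ∈ N | l ∈ A u} =
      ∑ C : Q.ConnectedComponent, #{u ∈ N | l ∈ A u ∧ u ∈ C.supp} := by
    intro l
    rw [card_eq_sum_card_fiberwise (f := Q.connectedComponentMk) (t := univ) (by simp)]
    refine sum_congr rfl fun C _ => ?_
    rw [filter_filter]
    congr 1
    exact filter_congr fun u _ => by rw [ConnectedComponent.mem_supp_iff]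
  obtain ⟨C, -, hC⟩ : ∃ C ∈ (univ : Finset Q.ConnectedComponent),
      #{u ∈ N | j ∈ A u ∧ u ∈ C.supp} < #{u ∈ N | i ∈ A u ∧ u ∈ C.supp} := by
    apply exists_lt_of_sum_lt
    rw [← hfib, ← hfib]
    omega
  have hle := card_missing_component_le hc hA hij C
  obtain ⟨c', hc', hcc'⟩ := exists_kempe_swap hc hi hj C.supp (by
    intro x y h hx
    exact (C.mem_supp_congr_adj h).1 hx)
  have hsplit : ∀ (p : V → Prop) [DecidablePred p], #{u ∈ N | p u} =
      #{u ∈ N | p u ∧ u ∈ C.supp} + #{u ∈ N | p u ∧ u ∉ C.supp} := by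
    intro p _
    rw [← card_filter_add_card_filter_not (s := {u ∈ N | p u}) (fun u => u ∈ C.supp),
      filter_filter, filter_filter]
  let A' : V → Finset κ := fun u =>
    if u ∈ C.supp then (A u).map (Equiv.swap i j).toEmbedding else A u
  have hmem : ∀ u l, l ∈ A' u ↔ if u ∈ C.supp then Equiv.swap i j l ∈ A u else l ∈ A u := by
    intro u l
    by_cases hu : u ∈ C.supp
    · simp only [A', hu, if_true, mem_map_equiv, Equiv.symm_swap]
    · simp only [A', hu, if_false]
  have hin : ∀ l, #{u ∈ N | l ∈ A' u ∧ u ∈ C.supp} =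
      #{u ∈ N | Equiv.swap i j l ∈ A u ∧ u ∈ C.supp} := by
    intro l
    congr 1
    refine filter_congr fun u _ => ?_
    rw [hmem]
    by_cases hu : u ∈ C.supp <;> simp only [hu, if_true, and_true, and_false]
  have hout : ∀ l, #{u ∈ N | l ∈ A' u ∧ u ∉ C.supp} = #{u ∈ N | l ∈ A u ∧ u ∉ C.supp} := by
    intro l
    congr 1
    refine filter_congr fun u _ => ?_
    rw [hmem]
    by_cases hu : u ∈ C.supp <;>
      simp only [hu, if_false, not_true, not_false_eq_true, and_true, and_false]
  refine ⟨c', A', hc', ?_, ?_, ?_⟩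
  · intro u hu l hl
    rw [hmem] at hl
    split_ifs at hl with hs
    · refine ⟨?_, fun y hy => ?_⟩
      · have := (hA u hu _ hl).1
        rw [Equiv.swap_apply_def] at this
        split_ifs at this with h1 h2
        · exact h1 ▸ hi
        · exact h2 ▸ hj
        · exact this
      · rw [hcc' u y hy, if_pos hs]
        intro h
        refine (hA u hu _ hl).2 y hy ?_
        rw [← h, Equiv.swap_apply_self]
    · refine ⟨(hA u hu _ hl).1, fun y hy => ?_⟩
      rw [hcc' u y hy, if_neg hs]
      exact (hA u hu _ hl).2 y hy
  · intro u
    simp only [A']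
    split_ifs <;> simp
  · refine sum_sq_lt_of_transfer K hi hj hij _ _ ?_ _ _ hC (by omega) ?_ ?_ hlt
    · intro l _ h1 h2
      rw [hsplit, hin, hout, Equiv.swap_apply_of_ne_of_ne h1 h2, ← hsplit]
    · rw [hsplit fun u => i ∈ A' u, hsplit fun u => i ∈ A u, hin, hout, Equiv.swap_apply_left]
      omega
    · rw [hsplit fun u => j ∈ A' u, hsplit fun u => j ∈ A u, hin, hout, Equiv.swap_apply_right]
      omega

/-- After suitable Kempe changes some color is available at exactly one vertex of `N`. -/
lemma exists_uniquely_missing (hc : IsProperEdgeColoring H c K)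
    {N : Finset V} {A : V → Finset κ} (hA : IsMissing H c K N A)
    (hodd : Odd (∑ u ∈ N, #(A u))) (hlt : ∑ u ∈ N, #(A u) < 2 * #K) :
    ∃ c' A', IsProperEdgeColoring H c' K ∧ IsMissing H c' K N A' ∧
      (∀ u, #(A' u) = #(A u)) ∧ ∃ k ∈ K, #{u ∈ N | k ∈ A' u} = 1 := by
  induction hm : ∑ l ∈ K, #{u ∈ N | l ∈ A u} ^ 2 using Nat.strong_induction_on
    generalizing c A with
  | _ m ih =>
  by_cases hbal : ∃ i ∈ K, ∃ j ∈ K, #{u ∈ N | j ∈ A u} + 3 ≤ #{u ∈ N | i ∈ A u}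
  · obtain ⟨i, hi, j, hj, hij⟩ := hbal
    obtain ⟨c₁, A₁, hc₁, hA₁, hcard₁, hlt₁⟩ := exists_more_balanced hc hi hj hA hij
    obtain ⟨c₂, A₂, hc₂, hA₂, hcard₂, hk⟩ := ih _ (hm ▸ hlt₁) hc₁ hA₁
      (by simpa only [hcard₁] using hodd) (by simpa only [hcard₁] using hlt) rfl
    exact ⟨c₂, A₂, hc₂, hA₂, fun u => (hcard₂ u).trans (hcard₁ u), hk⟩
  · refine ⟨c, A, hc, hA, fun _ => rfl, ?_⟩
    push Not at hbal
    have hdouble : ∑ l ∈ K, #{u ∈ N | l ∈ A u} = ∑ u ∈ N, #(A u) := by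
      simp only [card_filter]
      rw [sum_comm]
      refine sum_congr rfl fun u hu => ?_
      rw [← card_filter]
      congr 1
      ext l
      simp only [mem_filter, and_iff_right_iff_imp]
      exact fun hl => (hA u hu l hl).1
    rw [← hdouble] at hodd hlt
    by_contra! hne
    obtain ⟨j, hj, hj2⟩ : ∃ j ∈ K, #{u ∈ N | j ∈ A u} < 2 := by
      by_contra! h
      have := card_nsmul_le_sum K _ 2 h
      rw [smul_eq_mul] at this
      omega
    have hj1 := hne j hj
    refine (Nat.not_even_iff_odd.2 hodd) (even_sum _ fun l hl => ?_)
    have h1 := hbal l hl j hj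
    have h2 := hne l hl
    have : #{u ∈ N | l ∈ A u} = 0 ∨ #{u ∈ N | l ∈ A u} = 2 := by omega
    rcases this with h | h <;> rw [h] <;> decide

/-- The graph obtained from `H` by joining `v` to the vertices of `N`. -/
def addStar {V : Type*} (H : SimpleGraph V) (v : V) (N : Finset V) : SimpleGraph V :=
  H ⊔ SimpleGraph.fromRel fun x y => x = v ∧ y ∈ N

lemma exists_coloring_addStar (v : V) (hv : ∀ x, ¬ H.Adj v x)
    (hc : IsProperEdgeColoring H c K) (N : Finset V) (hvN : v ∉ N) (hNK : #N ≤ #K)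
    (A : V → Finset κ) (hA : IsMissing H c K N A) (u₀ : V)
    (hcard : ∀ u ∈ N, (if u = u₀ then 1 else 2) ≤ #(A u)) :
    ∃ c', IsProperEdgeColoring (addStar H v N) c' K := by
  induction hm : #N generalizing H c K N A u₀ with
  | zero =>
    rw [card_eq_zero] at hm
    subst hm
    refine ⟨c, ?_⟩
    have : addStar H v ∅ = H := by
      ext x y
      simp [addStar]
    rwa [this]
  | succ m ih =>
    obtain ⟨u₁, hu₁, hcard₁⟩ : ∃ u₁ ∈ N, ∀ u ∈ N, (if u = u₁ then 1 else 2) ≤ #(A u) := by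
      by_cases h : u₀ ∈ N
      · exact ⟨u₀, h, hcard⟩
      · obtain ⟨u₁, hu₁⟩ : N.Nonempty := card_pos.1 (by omega)
        refine ⟨u₁, hu₁, fun u hu => ?_⟩
        have := hcard u hu
        rw [if_neg (by rintro rfl; exact h hu)] at this
        split_ifs <;> omega
    have hB : ∀ u, ∃ B ⊆ A u, u ∈ N → #B = if u = u₁ then 1 else 2 := by
      intro u
      by_cases hu : u ∈ N
      · obtain ⟨B, hB, hB'⟩ := exists_subset_card_eq (hcard₁ u hu)
        exact ⟨B, hB, fun _ => hB'⟩
      · exact ⟨∅, by simp, fun h => absurd h hu⟩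
    choose B hBA hBcard using hB
    have hBm : IsMissing H c K N B := fun u hu i hi => hA u hu i (hBA u hi)
    have hsum : ∑ u ∈ N, #(B u) = 2 * m + 1 := by
      rw [sum_congr rfl hBcard, ← add_sum_erase N _ hu₁, if_pos rfl,
        sum_congr rfl (g := fun _ => 2) (fun u hu => if_neg (ne_of_mem_erase hu)), sum_const,
        card_erase_of_mem hu₁, hm, smul_eq_mul]
      omega
    obtain ⟨c₁, A₁, hc₁, hA₁, hcA₁, k, hk, hkcard⟩ := exists_uniquely_missing hc hBm
      (by rw [hsum]; exact odd_two_mul_add_one m) (by omega)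
    obtain ⟨u, hu⟩ := card_eq_one.1 hkcard
    have huN : u ∈ N ∧ k ∈ A₁ u := by
      have : u ∈ ({u ∈ N | k ∈ A₁ u} : Finset V) := by rw [hu]; simp
      simpa using this
    have huniq : ∀ w ∈ N, k ∈ A₁ w → w = u := by
      intro w hw hkw
      have : w ∈ ({u ∈ N | k ∈ A₁ u} : Finset V) := by simp [hw, hkw]
      rw [hu] at this
      simpa using this
    let H' : SimpleGraph V :=
      { Adj := fun x y => H.Adj x y ∧ c₁ x y ≠ k
        symm := ⟨fun x y h => ⟨h.1.symm, by rw [hc₁.symm y x]; exact h.2⟩⟩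
        loopless := ⟨fun x h => H.loopless.irrefl x h.1⟩ }
    have hc' : IsProperEdgeColoring H' c₁ (K.erase k) :=
      ⟨hc₁.symm, fun x y h => mem_erase.2 ⟨h.2, hc₁.mem x y h.1⟩,
        fun x y z h h' => hc₁.inj x y z h.1 h'.1⟩
    obtain ⟨c₂, hc₂⟩ := ih (H := H') (fun x h => hv x h.1) hc' (N.erase u)
      (fun h => hvN (mem_of_mem_erase h))
      (by rw [card_erase_of_mem huN.1, card_erase_of_mem hk]; omega) A₁
      (fun w hw i hi => by
        have hwN := mem_of_mem_erase hw
        refine ⟨mem_erase.2 ⟨?_, (hA₁ w hwN i hi).1⟩, fun y hy => (hA₁ w hwN i hi).2 y hy.1⟩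
        rintro rfl
        exact ne_of_mem_erase hw (huniq w hwN hi)) u₁
      (fun w hw => by rw [hcA₁, hBcard w (mem_of_mem_erase hw)])
      (by rw [card_erase_of_mem huN.1]; omega)
    have huk := (hA₁ u huN.1 k huN.2).2
    have hadj : ∀ x y, (addStar H v N).Adj x y → (addStar H' v (N.erase u)).Adj x y ∨
        (H.Adj x y ∧ c₁ x y = k) ∨ (x = v ∧ y = u) ∨ (x = u ∧ y = v) := by
      intro x y h
      simp only [addStar, sup_adj, fromRel_adj, mem_erase, H'] at h ⊢
      grind
    have hH' : ∀ x y, (addStar H' v (N.erase u)).Adj x y →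
        ¬ ((H.Adj x y ∧ c₁ x y = k) ∨ (x = v ∧ y = u) ∨ (x = u ∧ y = v)) := by
      intro x y h
      have hvx := hv x
      have hvy := hv y
      have := H.adj_comm x y
      simp only [addStar, sup_adj, fromRel_adj, mem_erase, H'] at h
      grind
    let R : V → V → Prop := fun x y =>
      (H.Adj x y ∧ c₁ x y = k) ∨ (x = v ∧ y = u) ∨ (x = u ∧ y = v)
    have hR : ∀ x y, R x y ↔ R y x := by
      intro x y
      simp only [R, H.adj_comm x y, hc₁.symm x y]
      tauto
    have hRinj : ∀ x y z, R x y → R x z → y = z := by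
      intro x y z hy hz
      have h1 := hc₁.inj x y z
      have h2 := hv y
      have h3 := hv z
      have h4 := huk y
      have h5 := huk z
      simp only [R] at hy hz
      grind
    refine ⟨fun x y => if R x y then k else c₂ x y, ⟨?_, ?_, ?_⟩⟩
    · intro x y
      simp only [hR x y, hc₂.symm x y]
    · intro x y h
      by_cases hr : R x y
      · simp only [hr, if_true, hk]
      · simp only [hr, if_false]
        exact mem_of_mem_erase (hc₂.mem x y ((hadj x y h).resolve_right hr))
    · intro x y z hy hz h
      by_cases hry : R x y <;> by_cases hrz : R x z
      · exact hRinj x y z hry hrz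
      · rw [if_pos hry, if_neg hrz] at h
        exact absurd h.symm
          (ne_of_mem_erase (hc₂.mem x z ((hadj x z hz).resolve_right hrz)))
      · rw [if_neg hry, if_pos hrz] at h
        exact absurd h (ne_of_mem_erase (hc₂.mem x y ((hadj x y hy).resolve_right hry)))
      · rw [if_neg hry, if_neg hrz] at h
        exact hc₂.inj x y z ((hadj x y hy).resolve_right hry)
          ((hadj x z hz).resolve_right hrz) h

/-- **Vizing's theorem**. -/
theorem exists_edgeColoring_of_degree_lt (G : SimpleGraph V) (K : Finset κ)
    (hdeg : ∀ x, #{y | G.Adj x y} < #K) : ∃ c, IsProperEdgeColoring G c K := by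
  rcases isEmpty_or_nonempty V with hV | ⟨⟨v₀⟩⟩
  · exact ⟨fun x => isEmptyElim x, fun x => isEmptyElim x, fun x => isEmptyElim x,
      fun x => isEmptyElim x⟩
  obtain ⟨k₀, -⟩ : K.Nonempty := card_pos.1 ((Nat.zero_le _).trans_lt (hdeg v₀))
  let R : Finset V → SimpleGraph V := fun W =>
    { Adj := fun x y => G.Adj x y ∧ x ∈ W ∧ y ∈ W
      symm := ⟨fun x y h => ⟨h.1.symm, h.2.2, h.2.1⟩⟩
      loopless := ⟨fun x h => G.loopless.irrefl x h.1⟩ }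
  have hR : ∀ W, ∃ c, IsProperEdgeColoring (R W) c K := by
    intro W
    induction W using Finset.induction_on with
    | empty =>
      exact ⟨fun _ _ => k₀, fun _ _ => rfl, fun x y h => absurd h.2.1 (notMem_empty x),
        fun x y z h => absurd h.2.1 (notMem_empty x)⟩
    | insert v W hvW ih =>
      obtain ⟨c, hc⟩ := ih
      have hext : R (insert v W) = addStar (R W) v {y ∈ W | G.Adj v y} := by
        ext x y
        have := G.adj_comm x y
        have : ¬ G.Adj x x := G.loopless.irrefl x
        simp only [R, addStar, sup_adj, fromRel_adj, mem_insert, mem_filter]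
        grind
      rw [hext]
      refine exists_coloring_addStar (H := R W) v (fun x h => hvW h.2.1) hc _ (by simp [hvW]) ?_
        (fun u => K \ ({y | (R W).Adj u y} : Finset V).image (c u)) ?_ v ?_
      · refine (card_le_card ?_).trans (hdeg v).le
        intro y
        simp
      · intro u hu i hi
        simp only [mem_sdiff, mem_image, mem_filter, mem_univ, true_and, not_exists,
          not_and] at hi
        exact hi
      · intro u hu
        rw [mem_filter] at hu
        have h1 := le_card_sdiff (({y | (R W).Adj u y} : Finset V).image (c u)) K
        have h2 : #(({y | (R W).Adj u y} : Finset V).image (c u)) ≤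
            #(({y | G.Adj u y} : Finset V).erase v) := by
          refine card_image_le.trans (card_le_card fun y => ?_)
          simp only [mem_filter, mem_univ, true_and, mem_erase, R]
          rintro ⟨h, -, hy⟩
          exact ⟨by rintro rfl; exact hvW hy, h⟩
        have hvu : v ∈ ({y | G.Adj u y} : Finset V) := by simpa using hu.2.symm
        rw [card_erase_of_mem hvu] at h2
        have h3 := hdeg u
        have h4 := card_pos.2 ⟨v, hvu⟩
        split_ifs <;> omega
  obtain ⟨c, hc⟩ := hR univ
  exact ⟨c, hc.symm, fun x y h => hc.mem x y ⟨h, mem_univ x, mem_univ y⟩,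
    fun x y z h h' => hc.inj x y z ⟨h, mem_univ x, mem_univ y⟩ ⟨h', mem_univ x, mem_univ z⟩⟩

end Vizing

section Circulant

open Finset
open scoped Classical

/-- The palette of a proper edge coloring may be replaced by any palette of the same size. -/
lemma IsProperEdgeColoring.exists_recolor {V κ κ' : Type*} [Nonempty κ'] {H : SimpleGraph V}
    {c : V → V → κ} {K : Finset κ} (hc : IsProperEdgeColoring H c K) (K' : Finset κ')
    (hK : #K ≤ #K') : ∃ c', IsProperEdgeColoring H c' K' := by
  obtain ⟨f⟩ : Nonempty (K ↪ K') := Function.Embedding.nonempty_of_card_le (by simpa using hK)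
  let d : κ' := Classical.arbitrary κ'
  let g : κ → κ' := fun i => if h : i ∈ K then f ⟨i, h⟩ else d
  have hg : ∀ i (h : i ∈ K), g i = f ⟨i, h⟩ := fun i h => dif_pos h
  refine ⟨fun x y => g (c x y), fun x y => by rw [hc.symm], fun x y h => ?_,
    fun x y z hy hz h => hc.inj x y z hy hz ?_⟩
  · rw [hg _ (hc.mem x y h)]
    exact (f _).2
  · rw [hg _ (hc.mem x y hy), hg _ (hc.mem x z hz)] at h
    simpa using f.injective (Subtype.ext h)

lemma cayley_adj_iff {n : ℕ} {S : Finset (ZMod n)} (hsym : ∀ s ∈ S, -s ∈ S)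
    (h0 : (0 : ZMod n) ∉ S) (x y : ZMod n) : (cayley n S).Adj x y ↔ y - x ∈ S := by
  rw [cayley, fromRel_adj]
  constructor
  · rintro ⟨-, h | h⟩
    · simpa using hsym _ h
    · exact h
  · intro h
    refine ⟨?_, Or.inr h⟩
    rintro rfl
    exact h0 (by simpa using h)

lemma card_neighbors_cayley_le {n : ℕ} [NeZero n] {S : Finset (ZMod n)}
    (hsym : ∀ s ∈ S, -s ∈ S) (h0 : (0 : ZMod n) ∉ S) (x : ZMod n) :
    #{y | (cayley n S).Adj x y} ≤ #S := by
  refine card_le_card_of_injOn (fun y => y - x) ?_ fun y _ z _ h => sub_left_injective h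
  intro y hy
  simpa [cayley_adj_iff hsym h0] using hy

/-- A circulant graph of even order whose connection set has an odd element and avoids `0` is
edge-colorable with as many colors as its degree. -/
lemma exists_edgeColoring_cayley {n : ℕ} [NeZero n] (h2 : 2 ∣ n) {T : Finset (ZMod n)}
    (hsym : ∀ s ∈ T, -s ∈ T) (h0 : (0 : ZMod n) ∉ T) {a : ZMod n} (ha : a ∈ T)
    (hodd : ZMod.castHom h2 (ZMod 2) a ≠ 0) :
    ∃ c, IsProperEdgeColoring (cayley n T) c (range #T) := by
  set p := ZMod.castHom h2 (ZMod 2) with hp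
  have hp1 : ∀ x, p x ≠ 0 → p x = 1 := fun x => (by decide : ∀ z : ZMod 2, z ≠ 0 → z = 1) _
  set E : Finset (ZMod n) := {t ∈ T | p t = 0} with hE
  set O : Finset (ZMod n) := {t ∈ T | ¬ p t = 0} with hO
  have hcard : #E + #O = #T := card_filter_add_card_filter_not _
  have haO : a ∈ O := mem_filter.2 ⟨ha, hodd⟩
  have hEsym : ∀ s ∈ E, -s ∈ E := by
    intro s hs
    rw [mem_filter] at hs ⊢
    exact ⟨hsym s hs.1, by rw [map_neg, hs.2, neg_zero]⟩
  have hE0 : (0 : ZMod n) ∉ E := fun h => h0 (mem_of_mem_filter 0 h)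
  obtain ⟨φ, hφ⟩ := exists_edgeColoring_of_degree_lt (cayley n E) (range (#E + 1)) (by
    intro x
    rw [card_range]
    refine Nat.lt_succ_of_le ?_
    convert card_neighbors_cayley_le hEsym hE0 x)
  have hφadj : ∀ x y, y - x ∈ T → p x = p y → (cayley n E).Adj x y := by
    intro x y h hxy
    rw [cayley_adj_iff hEsym hE0, mem_filter]
    exact ⟨h, by rw [map_sub, hxy, sub_self]⟩
  have hmiss : ∀ x, ∃ l ∈ range (#E + 1), ∀ y, (cayley n E).Adj x y → φ x y ≠ l := by
    intro x
    obtain ⟨l, hl, hl'⟩ := exists_mem_notMem_of_card_lt_card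
      (s := ({y | (cayley n E).Adj x y} : Finset (ZMod n)).image (φ x)) (t := range (#E + 1)) (by
        rw [card_range]
        exact Nat.lt_succ_of_le
          (card_image_le.trans (card_neighbors_cayley_le hEsym hE0 x)))
    refine ⟨l, hl, fun y hy h => hl' (mem_image.2 ⟨y, by simpa using hy, h⟩)⟩
  choose μ hμ hμ' using hmiss
  let D : ZMod n → ZMod n → ZMod n ⊕ ℕ := fun x y =>
    if y - x = a then Sum.inr (μ x) else Sum.inl (y - x)
  let c : ZMod n → ZMod n → ZMod n ⊕ ℕ := fun x y =>
    if p x = 0 then (if p y = 0 then Sum.inr (φ x y) else D x y)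
    else (if p y = 0 then D y x else Sum.inr (φ (x - a) (y - a)))
  have hc : IsProperEdgeColoring (cayley n T) c ((O.erase a).disjSum (range (#E + 1))) := by
    have hD : ∀ x y, y - x ∈ T → p x = 0 → p y ≠ 0 →
        D x y ∈ (O.erase a).disjSum (range (#E + 1)) := by
      intro x y h hx hy
      simp only [D]
      split_ifs with h1
      · exact inr_mem_disjSum.2 (hμ x)
      · refine inl_mem_disjSum.2 (mem_erase.2 ⟨h1, mem_filter.2 ⟨h, ?_⟩⟩)
        rwa [map_sub, hx, sub_zero]
    refine ⟨?_, ?_, ?_⟩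
    · intro x y
      simp only [c, hφ.symm x y, hφ.symm (x - a)]
      split_ifs <;> rfl
    · intro x y h
      rw [cayley_adj_iff hsym h0] at h
      simp only [c]
      split_ifs with hx hy hy
      · exact inr_mem_disjSum.2 (hφ.mem x y (hφadj x y h (hx.trans hy.symm)))
      · exact hD x y h hx hy
      · exact hD y x (by simpa using hsym _ h) hy hx
      · refine inr_mem_disjSum.2 (hφ.mem _ _ (hφadj _ _ (by simpa using h) ?_))
        rw [map_sub, map_sub, hp1 x hx, hp1 y hy]
    · intro x y z hy hz h
      rw [cayley_adj_iff hsym h0] at hy hz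
      simp only [c] at h
      have hpa := hp1 a hodd
      have hshift : ∀ w, w - x ∈ T → ¬ p x = 0 → ¬ p w = 0 →
          (cayley n E).Adj (x - a) (w - a) := by
        intro w hw h1 h2
        refine hφadj _ _ (by simpa using hw) ?_
        rw [map_sub, map_sub, hp1 x h1, hp1 w h2]
      have hxa : ∀ w, x - w = a → w = x - a := fun w hw => by rw [← hw]; ring
      split_ifs at h with h1 h2 h3 h3 h2 h3 h3
      · exact hφ.inj x y z (hφadj _ _ hy (h1.trans h2.symm)) (hφadj _ _ hz (h1.trans h3.symm))
          (Sum.inr_injective h)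
      · simp only [D] at h
        split_ifs at h
        exact absurd (Sum.inr_injective h) (hμ' x y (hφadj _ _ hy (h1.trans h2.symm)))
      · simp only [D] at h
        split_ifs at h
        exact absurd (Sum.inr_injective h).symm (hμ' x z (hφadj _ _ hz (h1.trans h3.symm)))
      · simp only [D] at h
        split_ifs at h with h4 h5 h5
        · exact sub_left_injective (h4.trans h5.symm)
        · exact sub_left_injective (Sum.inl_injective h)
      · simp only [D] at h
        split_ifs at h with h4 h5 h5
        · exact (hxa y h4).trans (hxa z h5).symm
        · exact sub_right_injective (Sum.inl_injective h)
      · simp only [D] at h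
        split_ifs at h with h4
        rw [hxa y h4] at h
        exact absurd (Sum.inr_injective h).symm (hμ' _ _ (hshift z hz h1 h3))
      · simp only [D] at h
        split_ifs at h with h4
        rw [hxa z h4] at h
        exact absurd (Sum.inr_injective h) (hμ' _ _ (hshift y hy h1 h2))
      · exact sub_left_injective (hφ.inj _ _ _ (hshift y hy h1 h2) (hshift z hz h1 h3)
          (Sum.inr_injective h))
  refine hc.exists_recolor _ ?_
  have := card_pos.2 ⟨a, haO⟩
  rw [card_disjSum, card_erase_of_mem haO, card_range, card_range]
  omega

end Circulant

section PowerOfCycle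

/-- Reduction modulo `2 * k` of a number below `4 * k`. -/
def foldHalf (k X : ℕ) : ℕ := if X < 2 * k then X else X - 2 * k

/-- The sum modulo `2 * k + 1` of the reductions of `X` and `Y` modulo `2 * k`. -/
def foldSum (k X Y : ℕ) : ℕ :=
  if foldHalf k X + foldHalf k Y < 2 * k + 1 then foldHalf k X + foldHalf k Y
  else foldHalf k X + foldHalf k Y - (2 * k + 1)

/-- The color of the edge `{X, Y}` of the power of cycle `C_{4k}^k`. -/
def cyclePowerColor (k X Y : ℕ) : ℕ :=
  if (foldHalf k X + k = foldHalf k Y ∨ foldHalf k Y + k = foldHalf k X) ∧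
      ¬ (X < 2 * k ↔ Y < 2 * k) then 2 * k + 1
  else foldSum k X Y

/-- `X` and `Y` are at cyclic distance between `1` and `k` modulo `4 * k`. -/
def CycleNear (k X Y : ℕ) : Prop :=
  (X < Y ∧ Y ≤ X + k) ∨ (Y < X ∧ X ≤ Y + k) ∨ X + 3 * k ≤ Y ∨ Y + 3 * k ≤ X

lemma foldSum_lt {k X Y : ℕ} (hX : X < 4 * k) (hY : Y < 4 * k) : foldSum k X Y < 2 * k + 1 := by
  unfold foldSum foldHalf
  split_ifs <;> omega

lemma foldSum_comm (k X Y : ℕ) : foldSum k X Y = foldSum k Y X := by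
  unfold foldSum
  simp only [add_comm]

lemma cyclePowerColor_comm (k X Y : ℕ) : cyclePowerColor k X Y = cyclePowerColor k Y X := by
  unfold cyclePowerColor
  rw [foldSum_comm k X Y]
  exact if_congr (by tauto) rfl rfl

lemma cyclePowerColor_lt {k X Y : ℕ} (hX : X < 4 * k) (hY : Y < 4 * k) :
    cyclePowerColor k X Y < 2 * k + 2 := by
  have := foldSum_lt hX hY
  unfold cyclePowerColor
  split_ifs <;> omega

lemma foldHalf_eq_of_foldSum_eq {k X Y Z : ℕ} (hY : Y < 4 * k)
    (hZ : Z < 4 * k) (h : foldSum k X Y = foldSum k X Z) : foldHalf k Y = foldHalf k Z := by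
  have h1 : foldHalf k Y < 2 * k := by unfold foldHalf; split_ifs <;> omega
  have h2 : foldHalf k Z < 2 * k := by unfold foldHalf; split_ifs <;> omega
  unfold foldSum at h
  split_ifs at h <;> omega

lemma foldHalf_eq_of_foldSum_self_eq {k X Y : ℕ} (hX : X < 4 * k) (hY : Y < 4 * k)
    (h : foldSum k X X = foldSum k Y Y) : foldHalf k X = foldHalf k Y := by
  have h1 : foldHalf k X < 2 * k := by unfold foldHalf; split_ifs <;> omega
  have h2 : foldHalf k Y < 2 * k := by unfold foldHalf; split_ifs <;> omega
  unfold foldSum at h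
  split_ifs at h <;> omega

lemma eq_or_of_foldHalf_eq {k X Y : ℕ} (h : foldHalf k X = foldHalf k Y) :
    X = Y ∨ X = Y + 2 * k ∨ Y = X + 2 * k := by
  unfold foldHalf at h
  split_ifs at h <;> omega

lemma cyclePowerColor_inj {k X Y Z : ℕ} (hX : X < 4 * k) (hY : Y < 4 * k) (hZ : Z < 4 * k)
    (hXY : CycleNear k X Y) (hXZ : CycleNear k X Z)
    (h : cyclePowerColor k X Y = cyclePowerColor k X Z) : Y = Z := by
  have h1 := foldSum_lt hX hY
  have h2 := foldSum_lt hX hZ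
  unfold cyclePowerColor at h
  unfold CycleNear at hXY hXZ
  split_ifs at h with hA hB hB
  · unfold foldHalf at hA hB
    split_ifs at hA hB <;> omega
  · omega
  · omega
  · have h3 := foldHalf_eq_of_foldSum_eq hY hZ h
    unfold foldHalf at hA hB h3
    split_ifs at hA hB h3 <;> omega

lemma cyclePowerColor_ne_foldSum {k X Y : ℕ} (hX : X < 4 * k) (hY : Y < 4 * k)
    (hXY : CycleNear k X Y) : cyclePowerColor k X Y ≠ foldSum k X X := by
  intro h
  have h1 := foldSum_lt hX hX
  unfold cyclePowerColor at h
  unfold CycleNear at hXY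
  split_ifs at h
  · omega
  · have := eq_or_of_foldHalf_eq (foldHalf_eq_of_foldSum_eq hY hX h)
    omega

end PowerOfCycle

lemma totalChromaticNumber_le {V : Type*} {G : SimpleGraph V} {t : ℕ} (ht : 0 < t)
    (cv : V → ℕ) (ce : V → V → ℕ) (hsymm : ∀ x y, ce x y = ce y x)
    (hcv : ∀ x, cv x < t) (hce : ∀ x y, G.Adj x y → ce x y < t)
    (hvv : ∀ x y, G.Adj x y → cv x ≠ cv y)
    (hee : ∀ x y z, G.Adj x y → G.Adj x z → ce x y = ce x z → y = z)
    (hve : ∀ x y, G.Adj x y → ce x y ≠ cv x) : totalChromaticNumber G ≤ t := by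
  let ce' : Sym2 V → Fin t := fun e => ⟨Sym2.lift ⟨ce, hsymm⟩ e % t, Nat.mod_lt _ ht⟩
  have hce' : ∀ x y, G.Adj x y → (ce' s(x, y) : ℕ) = ce x y := fun x y h =>
    Nat.mod_eq_of_lt (hce x y h)
  refine Nat.sInf_le ⟨fun x => ⟨cv x, hcv x⟩, ce', ?_, ?_, ?_⟩
  · intro x y h h'
    exact hvv x y h (congrArg Fin.val h')
  · rintro e₁ h₁ e₂ h₂ hne ⟨u, hu₁, hu₂⟩ h
    obtain ⟨y, rfl⟩ := hu₁
    obtain ⟨z, rfl⟩ := hu₂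
    rw [mem_edgeSet] at h₁ h₂
    refine hne ?_
    rw [hee u y z h₁ h₂]
    rw [← hce' u y h₁, ← hce' u z h₂, h]
  · rintro e he u ⟨y, rfl⟩ h
    rw [mem_edgeSet] at he
    refine hve u y he ?_
    rw [← hce' u y he, h]

lemma ZMod.val_add_natCast_cases {n : ℕ} [NeZero n] (x : ZMod n) {j : ℕ} (hj : j < n) :
    (x + (j : ZMod n)).val = x.val + j ∨ (x + (j : ZMod n)).val + n = x.val + j := by
  have hx := x.val_lt
  rw [ZMod.val_add, ZMod.val_natCast, Nat.mod_eq_of_lt hj]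
  rcases lt_or_ge (x.val + j) n with h | h
  · exact Or.inl (Nat.mod_eq_of_lt h)
  · right
    rw [Nat.mod_eq_sub_mod h, Nat.mod_eq_of_lt (by omega)]
    omega

/-- Theorem 3.1: a circulant graph of even order `n` (here divisible by 4) with `Δ ≥ n/2`,
whose connection set avoids the involution `n/2`, contains
`S₁ = {1, …, n/4} ∪ {n - n/4, …, n - 1}`, and is such that `S \ S₁` generates `ZMod n`,
satisfies the TCC. -/
theorem circulant_tcc (n : ℕ) (hn : 0 < n) (h4 : 4 ∣ n) (S : Finset (ZMod n))
    (hsym : ∀ s ∈ S, -s ∈ S) (h0 : (0 : ZMod n) ∉ S)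
    (hinv : ((n / 2 : ℕ) : ZMod n) ∉ S)
    (hS1 : {x : ZMod n | ∃ j : ℕ, 1 ≤ j ∧ j ≤ n / 4 ∧ (x = (j : ZMod n) ∨ x = -(j : ZMod n))}
      ⊆ ↑S)
    (hgen : AddSubgroup.closure ((↑S : Set (ZMod n)) \
      {x : ZMod n | ∃ j : ℕ, 1 ≤ j ∧ j ≤ n / 4 ∧ (x = (j : ZMod n) ∨ x = -(j : ZMod n))}) = ⊤)
    (hdeg : n / 2 ≤ S.card) :
    totalChromaticNumber (cayley n S) ≤ S.card + 2 := by
  classical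
  have : NeZero n := ⟨hn.ne'⟩
  set S₁ : Set (ZMod n) :=
    {x : ZMod n | ∃ j : ℕ, 1 ≤ j ∧ j ≤ n / 4 ∧ (x = (j : ZMod n) ∨ x = -(j : ZMod n))} with hS₁
  obtain ⟨k, hk⟩ := h4
  have hk4 : n / 4 = k := by omega
  have hk2 : n / 2 = 2 * k := by omega
  have h2 : 2 ∣ n := ⟨2 * k, by omega⟩
  set T : Finset (ZMod n) := {t ∈ S | t ∉ S₁} with hT
  have hTS : ((S : Set (ZMod n)) \ S₁) = T := by
    ext x
    simp [hT]
  have hS₁neg : ∀ s, -s ∈ S₁ → s ∈ S₁ := by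
    rintro s ⟨j, h1, h2, h3⟩
    exact ⟨j, h1, h2, h3.symm.imp neg_inj.1 neg_eq_iff_eq_neg.1⟩
  have hTsym : ∀ s ∈ T, -s ∈ T := by
    intro s hs
    rw [Finset.mem_filter] at hs ⊢
    exact ⟨hsym s hs.1, fun h => hs.2 (hS₁neg s h)⟩
  have hT0 : (0 : ZMod n) ∉ T := fun h => h0 (Finset.mem_of_mem_filter 0 h)
  obtain ⟨a, haT, ha⟩ : ∃ a ∈ T, ZMod.castHom h2 (ZMod 2) a ≠ 0 := by
    by_contra! h
    have hle : AddSubgroup.closure ((S : Set (ZMod n)) \ S₁) ≤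
        (ZMod.castHom h2 (ZMod 2)).toAddMonoidHom.ker := by
      rw [AddSubgroup.closure_le, hTS]
      exact fun x hx => h x hx
    rw [hgen] at hle
    have h1 : ZMod.castHom h2 (ZMod 2) 1 = 0 := hle (AddSubgroup.mem_top 1)
    rw [map_one] at h1
    exact one_ne_zero h1
  obtain ⟨g, hg⟩ := exists_edgeColoring_cayley h2 hTsym hT0 haT ha
  have hcard : T.card + 2 * k ≤ S.card := by
    have hsplit : ({t ∈ S | t ∈ S₁} : Finset (ZMod n)).card + T.card = S.card :=
      Finset.card_filter_add_card_filter_not _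
    have himg : ((Finset.Icc 1 k ∪ Finset.Ico (3 * k) (4 * k)).image
        (fun j : ℕ => (j : ZMod n))) ⊆ {t ∈ S | t ∈ S₁} := by
      intro x hx
      obtain ⟨j, hj, rfl⟩ := Finset.mem_image.1 hx
      have hmem : ((j : ℕ) : ZMod n) ∈ S₁ := by
        rw [Finset.mem_union, Finset.mem_Icc, Finset.mem_Ico] at hj
        rcases hj with hj | hj
        · exact ⟨j, hj.1, by omega, Or.inl rfl⟩
        · refine ⟨n - j, by omega, by omega, Or.inr ?_⟩
          rw [Nat.cast_sub (by omega), ZMod.natCast_self, zero_sub, neg_neg]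
      exact Finset.mem_filter.2 ⟨hS1 hmem, hmem⟩
    have hle := Finset.card_le_card himg
    rw [Finset.card_image_of_injOn, Finset.card_union_of_disjoint, Nat.card_Icc,
      Nat.card_Ico] at hle
    · omega
    · rw [Finset.disjoint_left]
      intro j h1 h2
      rw [Finset.mem_Icc] at h1
      rw [Finset.mem_Ico] at h2
      omega
    · have hlt : ∀ i ∈ Finset.Icc 1 k ∪ Finset.Ico (3 * k) (4 * k), i < n := by
        intro i hi
        rw [Finset.mem_union, Finset.mem_Icc, Finset.mem_Ico] at hi
        omega
      intro i hi j hj hij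
      have := congrArg ZMod.val hij
      rwa [ZMod.val_natCast_of_lt (hlt i hi), ZMod.val_natCast_of_lt (hlt j hj)] at this
  have hlt : ∀ x : ZMod n, x.val < 4 * k := fun x => hk ▸ x.val_lt
  have hnear : ∀ x y : ZMod n, y - x ∈ S₁ → CycleNear k x.val y.val := by
    rintro x y ⟨j, hj1, hjk, h | h⟩
    · have hy : y = x + j := by rw [← h]; ring
      have := ZMod.val_add_natCast_cases x (j := j) (by omega)
      rw [← hy] at this
      have hx := hlt x
      have hy := hlt y
      unfold CycleNear
      omega
    · have hx : x = y + j := by rw [← neg_eq_iff_eq_neg.2 h]; ring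
      have := ZMod.val_add_natCast_cases y (j := j) (by omega)
      rw [← hx] at this
      have hx := hlt x
      have hy := hlt y
      unfold CycleNear
      omega
  have hadj : ∀ x y, (cayley n S).Adj x y → y - x ∉ S₁ → (cayley n T).Adj x y := by
    intro x y h h'
    rw [cayley_adj_iff hsym h0] at h
    rw [cayley_adj_iff hTsym hT0]
    exact Finset.mem_filter.2 ⟨h, h'⟩
  have hgt : ∀ x y, (cayley n S).Adj x y → y - x ∉ S₁ → g x y < T.card := fun x y h h' =>
    Finset.mem_range.1 (hg.mem x y (hadj x y h h'))
  refine totalChromaticNumber_le (by omega) (fun x => foldSum k x.val x.val)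
    (fun x y => if y - x ∈ S₁ then cyclePowerColor k x.val y.val else 2 * k + 2 + g x y)
    ?_ ?_ ?_ ?_ ?_ ?_
  · intro x y
    have hiff : y - x ∈ S₁ ↔ x - y ∈ S₁ := by
      constructor <;> intro h <;> refine hS₁neg _ ?_ <;> rwa [neg_sub]
    simp only [hiff, cyclePowerColor_comm k x.val, hg.symm x y]
  · intro x
    have := foldSum_lt (hlt x) (hlt x)
    omega
  · intro x y h
    have h1 := cyclePowerColor_lt (hlt x) (hlt y)
    have h2 := hgt x y h
    split_ifs with h3
    · omega
    · have := h2 h3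
      omega
  · intro x y h heq
    rw [cayley_adj_iff hsym h0] at h
    have hhalf : ∀ z w : ZMod n, z.val = w.val + 2 * k → z - w = ((n / 2 : ℕ) : ZMod n) := by
      intro z w hzw
      rw [← ZMod.natCast_zmod_val z, hzw, hk2, Nat.cast_add, ZMod.natCast_zmod_val]
      ring
    rcases eq_or_of_foldHalf_eq (foldHalf_eq_of_foldSum_self_eq (hlt x) (hlt y) heq)
      with h1 | h1 | h1
    · rw [ZMod.val_injective n h1, sub_self] at h
      exact h0 h
    · have := hsym _ h
      rw [neg_sub, hhalf x y h1] at this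
      exact hinv this
    · rw [hhalf y x h1] at h
      exact hinv h
  · intro x y z hy hz h
    have h1 := cyclePowerColor_lt (hlt x) (hlt y)
    have h2 := cyclePowerColor_lt (hlt x) (hlt z)
    split_ifs at h with h3 h4 h4
    · exact ZMod.val_injective n
        (cyclePowerColor_inj (hlt x) (hlt y) (hlt z) (hnear x y h3) (hnear x z h4) h)
    · omega
    · omega
    · exact hg.inj x y z (hadj x y hy h3) (hadj x z hz h4) (by omega)
  · intro x y h
    have h1 := foldSum_lt (hlt x) (hlt x)
    split_ifs with h2
    · exact cyclePowerColor_ne_foldSum (hlt x) (hlt y) (hnear x y h2)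
    · omega
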